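/- For a partition $\lambda$ and $n$-tuple $\nu=(\nu_1,\dots,\nu_n)\in\mathbb{Z}^n$, the following partial fraction identity holds: $\sum_{k=1}^n (q^{-\nu_k}-1)\prod_{i\neq k}\frac{x_k - q^{-\nu_i}x_i}{x_k - x_i} = q^{-|\nu|}-1$, where $|\nu| = \sum_{i=1}^n \nu_i$, assuming the $x_i$ are distinct. -/

import Mathlib

section PartialFractions

variable {ι K : Type*} [DecidableEq ι] [Field K] {s : Finset ι} {x : ι → K}

open Polynomial Lagrange in
/-- Lagrange interpolation of `∏ (X - a i * x i) - ∏ (X - x i)` at the nodes `x`, evaluated at `0`. -/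
theorem sum_sub_one_mul_prod_div_of_ne_zero (hx : Set.InjOn x s) (h0 : ∀ i ∈ s, x i ≠ 0)
    (a : ι → K) :
    ∑ k ∈ s, (a k - 1) * ∏ i ∈ s.erase k, (x k - a i * x i) / (x k - x i)
      = ∏ i ∈ s, a i - 1 := by
  have hdeg : (nodal s (fun i => a i * x i) - nodal s x).degree < s.card := by
    rw [← degree_nodal (R := K) (s := s) (v := fun i => a i * x i)]
    exact degree_sub_lt_left (by simp [degree_nodal]) nodal_ne_zero
      (by rw [nodal_monic.leadingCoeff, nodal_monic.leadingCoeff])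
  have h := congrArg (eval 0) (eq_interpolate hx hdeg)
  have hprod : ∏ i ∈ s, -x i ≠ 0 :=
    Finset.prod_ne_zero_iff.2 fun i hi => neg_ne_zero.2 (h0 i hi)
  have hl : eval 0 (nodal s (fun i => a i * x i) - nodal s x)
      = (∏ i ∈ s, -x i) * (∏ i ∈ s, a i - 1) := by
    rw [eval_sub, eval_nodal, eval_nodal, mul_sub, mul_one, ← Finset.prod_mul_distrib]
    congr 1
    · exact Finset.prod_congr rfl fun i _ => by ring
    · exact Finset.prod_congr rfl fun i _ => by ring
  rw [hl, interpolate_apply, eval_finsetSum] at h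
  refine mul_left_cancel₀ hprod (Eq.trans ?_ h.symm)
  rw [Finset.mul_sum]
  refine Finset.sum_congr rfl fun k hk => ?_
  rw [eval_mul, eval_C, eval_sub, eval_nodal_at_node hk, eval_nodal, Lagrange.basis, eval_prod,
    ← Finset.mul_prod_erase s _ hk, ← Finset.mul_prod_erase s (fun i => x k - a i * x i) hk]
  have hb : ∏ i ∈ s.erase k, eval 0 (basisDivisor (x k) (x i))
      = (∏ i ∈ s.erase k, -x i) / ∏ i ∈ s.erase k, (x k - x i) := by
    rw [← Finset.prod_div_distrib]
    refine Finset.prod_congr rfl fun i _ => ?_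
    simp [basisDivisor, div_eq_inv_mul]
  rw [hb, Finset.prod_div_distrib]
  ring

theorem sum_sub_one_mul_prod_div (hx : Set.InjOn x s) (a : ι → K) :
    ∑ k ∈ s, (a k - 1) * ∏ i ∈ s.erase k, (x k - a i * x i) / (x k - x i)
      = ∏ i ∈ s, a i - 1 := by
  by_cases h0 : ∀ i ∈ s, x i ≠ 0
  · exact sum_sub_one_mul_prod_div_of_ne_zero hx h0 a
  push Not at h0
  obtain ⟨j, hj, hxj⟩ := h0
  have hne : ∀ i ∈ s.erase j, x i ≠ 0 := fun i hi h =>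
    Finset.ne_of_mem_erase hi (hx (Finset.mem_of_mem_erase hi) hj (h.trans hxj.symm))
  have hrest := sum_sub_one_mul_prod_div_of_ne_zero
    (hx.mono (Finset.coe_subset.2 (Finset.erase_subset j s))) hne a
  have hterm : ∏ i ∈ s.erase j, (x j - a i * x i) / (x j - x i) = ∏ i ∈ s.erase j, a i :=
    Finset.prod_congr rfl fun i hi => by
      have := hne i hi
      rw [hxj]
      field_simp
      ring
  have hothers : ∑ k ∈ s.erase j, (a k - 1) * ∏ i ∈ s.erase k, (x k - a i * x i) / (x k - x i)
      = ∏ i ∈ s.erase j, a i - 1 := by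
    rw [← hrest]
    refine Finset.sum_congr rfl fun k hk => ?_
    have hjk : j ∈ s.erase k := Finset.mem_erase.2 ⟨(Finset.ne_of_mem_erase hk).symm, hj⟩
    rw [← Finset.mul_prod_erase _ _ hjk, Finset.erase_right_comm, hxj, mul_zero, sub_zero,
      div_self (hne k hk), one_mul]
  rw [← Finset.add_sum_erase s _ hj, hothers, hterm, ← Finset.mul_prod_erase s a hj]
  ring

theorem zpow_sum_eq_prod_zpow {q : K} (hq : q ≠ 0) (s : Finset ι) (m : ι → ℤ) :
    q ^ (∑ i ∈ s, m i) = ∏ i ∈ s, q ^ m i := by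
  induction s using Finset.induction_on with
  | empty => simp
  | insert i s hi ih => rw [Finset.sum_insert hi, Finset.prod_insert hi, zpow_add₀ hq, ih]

end PartialFractions

/-- partial fraction identity
  ∑_k (q^{-ν_k}-1) ∏_{i≠k} (x_k - q^{-ν_i}x_i)/(x_k - x_i) = q^{-|ν|} - 1. -/
theorem partial_fraction_sum {K : Type*} [Field K] (n : ℕ) (q : K) (hq : q ≠ 0)
    (x : Fin n → K) (hx : Function.Injective x) (ν : Fin n → ℤ) :
    ∑ k : Fin n, (q ^ (-ν k) - 1) *
        ∏ i ∈ Finset.univ.erase k, (x k - q ^ (-ν i) * x i) / (x k - x i)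
    = q ^ (-(∑ i : Fin n, ν i)) - 1 := by
  rw [sum_sub_one_mul_prod_div hx.injOn fun i => q ^ (-ν i), ← Finset.sum_neg_distrib]
  congr 1
  exact (zpow_sum_eq_prod_zpow hq _ _).symm
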